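/- For the 2-particle Ruijsenaars Lax matrix L(u) = D(u)E(u) with D(u) = [(1−t)(t²−u)/(2t^{3/2}(1−u))]·diag(v₁₂T_{x₁}, v₂₁T_{x₂}) and E_{jk} = (t²+u)/(t²−u) − (tx_j+x_k)/(tx_j−x_k), the characteristic polynomial satisfies t(1−u)·det(z·I − L(u)) = t(1−u)z² − t^{1/2}(t−u)H₁z + (t²−u)H₂, where H₁ = v₁₂T_{x₁} + v₂₁T_{x₂}, H₂ = T_{x₁}T_{x₂}, and v_{jk} = (t^{1/2}x_j−t^{−1/2}x_k)/(x_j−x_k). -/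

import Mathlib

/-- The characteristic polynomial identity for the 2-particle trigonometric
Ruijsenaars Lax matrix L(u) = D(u)E(u):
t(1−u)·det(z·I − L(u)) = t(1−u)z² − t^{1/2}(t−u)H₁z + (t²−u)H₂, where
H₁ = v₁₂T₁ + v₂₁T₂, H₂ = T₁T₂, v_{jk} = (t^{1/2}x_j−t^{−1/2}x_k)/(x_j−x_k),
D(u) = [(1−t)(t²−u)/(2t^{3/2}(1−u))]·diag(v₁₂T₁, v₂₁T₂),
E_{jk} = (t²+u)/(t²−u) − (tx_j+x_k)/(tx_j−x_k), and s = t^{1/2}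
(so t^{3/2} = s·t).  T₁, T₂ are commuting scalar (classical) momenta. -/
theorem ruijsenaars_characteristic_polynomial (t s u z x1 x2 T1 T2 : ℂ)
    (hs : s ^ 2 = t) (hs0 : s ≠ 0) (ht1 : t ≠ 1) (hu : u ≠ 1) (htu : t ^ 2 ≠ u)
    (h12 : x1 ≠ x2) (hx1 : x1 ≠ 0) (hx2 : x2 ≠ 0)
    (hx12 : t * x1 ≠ x2) (hx21 : t * x2 ≠ x1) :
    t * (1 - u) *
        (z • (1 : Matrix (Fin 2) (Fin 2) ℂ) -
          (((1 - t) * (t ^ 2 - u) / (2 * s * t * (1 - u))) •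
              !![(s * x1 - s⁻¹ * x2) / (x1 - x2) * T1, 0;
                 0, (s * x2 - s⁻¹ * x1) / (x2 - x1) * T2]) *
            !![(t ^ 2 + u) / (t ^ 2 - u) - (t * x1 + x1) / (t * x1 - x1),
               (t ^ 2 + u) / (t ^ 2 - u) - (t * x1 + x2) / (t * x1 - x2);
               (t ^ 2 + u) / (t ^ 2 - u) - (t * x2 + x1) / (t * x2 - x1),
               (t ^ 2 + u) / (t ^ 2 - u) - (t * x2 + x2) / (t * x2 - x2)]).det
      = t * (1 - u) * z ^ 2
        - s * (t - u) *
            ((s * x1 - s⁻¹ * x2) / (x1 - x2) * T1 +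
              (s * x2 - s⁻¹ * x1) / (x2 - x1) * T2) * z
        + (t ^ 2 - u) * (T1 * T2) := by
  subst hs
  have a1 : x1 - x2 ≠ 0 := sub_ne_zero.mpr h12
  have a2 : x2 - x1 ≠ 0 := sub_ne_zero.mpr h12.symm
  have a3 : s ^ 2 * x1 - x2 ≠ 0 := sub_ne_zero.mpr hx12
  have a4 : s ^ 2 * x2 - x1 ≠ 0 := sub_ne_zero.mpr hx21
  have a5 : (s ^ 2) ^ 2 - u ≠ 0 := sub_ne_zero.mpr htu
  have a6 : 1 - u ≠ 0 := sub_ne_zero.mpr hu.symm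
  have a7 : s ^ 2 - 1 ≠ 0 := sub_ne_zero.mpr ht1
  have e1 : ∀ x : ℂ, x ≠ 0 → ((s ^ 2) ^ 2 + u) / ((s ^ 2) ^ 2 - u) -
      (s ^ 2 * x + x) / (s ^ 2 * x - x) =
      -2 * s ^ 2 * (s ^ 2 - u) / (((s ^ 2) ^ 2 - u) * (s ^ 2 - 1)) := by
    intro x hx
    have h : s ^ 2 * x - x = (s ^ 2 - 1) * x := by ring
    rw [h, div_sub_div _ _ a5 (mul_ne_zero a7 hx),
      div_eq_div_iff (mul_ne_zero a5 (mul_ne_zero a7 hx)) (mul_ne_zero a5 a7)]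
    ring
  have e2 : ∀ x y : ℂ, s ^ 2 * x - y ≠ 0 → ((s ^ 2) ^ 2 + u) / ((s ^ 2) ^ 2 - u) -
      (s ^ 2 * x + y) / (s ^ 2 * x - y) =
      2 * s ^ 2 * (u * x - s ^ 2 * y) / (((s ^ 2) ^ 2 - u) * (s ^ 2 * x - y)) := by
    intro x y h
    rw [div_sub_div _ _ a5 h]
    congr 1
    ring
  have v1 : (s * x1 - s⁻¹ * x2) / (x1 - x2) = (s ^ 2 * x1 - x2) / (s * (x1 - x2)) := by
    field_simp
  have v2 : (s * x2 - s⁻¹ * x1) / (x2 - x1) = -((s ^ 2 * x2 - x1) / (s * (x1 - x2))) := by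
    rw [← neg_sub x1 x2, div_neg]
    field_simp
  rw [e1 x1 hx1, e1 x2 hx2, e2 x1 x2 a3, e2 x2 x1 a4, v1, v2]
  have d1 : ∀ w : ℂ, (1 - s ^ 2) * ((s ^ 2) ^ 2 - u) / (2 * s * s ^ 2 * (1 - u)) * w *
      (-2 * s ^ 2 * (s ^ 2 - u) / (((s ^ 2) ^ 2 - u) * (s ^ 2 - 1))) =
      (s ^ 2 - u) / (s * (1 - u)) * w := by
    intro w
    generalize hq : (s ^ 2) ^ 2 - u = q at *
    rw [← neg_sub (s ^ 2) 1]
    generalize s ^ 2 - 1 = r at *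
    field_simp
  have d2 : ∀ w n m : ℂ, m ≠ 0 →
      (1 - s ^ 2) * ((s ^ 2) ^ 2 - u) / (2 * s * s ^ 2 * (1 - u)) * w *
      (2 * s ^ 2 * n / (((s ^ 2) ^ 2 - u) * m)) =
      (1 - s ^ 2) / (s * (1 - u)) * w * n / m := by
    intro w n m hm
    generalize hq : (s ^ 2) ^ 2 - u = q at *
    field_simp
  simp only [Matrix.det_fin_two, Matrix.sub_apply, Matrix.smul_apply, Matrix.mul_apply,
    Fin.sum_univ_two, Matrix.one_apply, Matrix.of_apply, Matrix.cons_val', Matrix.cons_val_zero,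
    Matrix.cons_val_one, Matrix.cons_val_fin_one, smul_eq_mul, mul_zero, zero_mul, add_zero,
    zero_add, if_true, mul_one, d1, d2 _ _ _ a3, d2 _ _ _ a4]
  simp only [zero_ne_one, one_ne_zero, if_false, mul_zero, zero_sub, Fin.isValue]
  field_simp
  ring
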